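/- arXiv:2003.08497 — 2 statements merged into one kernel-verified Lean document; each statement's English description precedes it below -/
import Mathlib

section
/- Let d be a graphical degree sequence of length n satisfying M(d) > 2·J(d) + 18·Δ(d) + 56. Then d is (8,8)-stable; that is, |Ω(d')| ≤ M(d)^8 · |Ω(d)| for every graphical degree sequence d' of length n with ‖d' − d‖₁ ≤ 8. -/
open Finset

/-- The degree of vertex `i` in the simple graph `G`. -/
noncomputable def degOf {n : ℕ} (G : SimpleGraph (Fin n)) (i : Fin n) : ℕ :=
  (G.neighborSet i).ncard

/-- `Omega d` is the set of simple graphs on `{1,…,n}` with degree sequence `d`. -/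
def Omega {n : ℕ} (d : Fin n → ℕ) : Set (SimpleGraph (Fin n)) :=
  {G | ∀ i, degOf G i = d i}

/-- A degree sequence is graphical if it is realised by some simple graph. -/
def Graphical {n : ℕ} (d : Fin n → ℕ) : Prop := (Omega d).Nonempty

/-- `M(d)`, the sum of the entries of `d`. -/
def Mdeg {n : ℕ} (d : Fin n → ℕ) : ℕ := ∑ i, d i

/-- `Δ(d)`, the maximum entry of `d`. -/
def Δdeg {n : ℕ} (d : Fin n → ℕ) : ℕ := Finset.univ.sup d

/-- The sum of the `k` largest entries of `d`, expressed as the maximum of the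
sum of `d` over the subsets of size `k`. -/
def sumLargest {n : ℕ} (k : ℕ) (d : Fin n → ℕ) : ℕ :=
  (Finset.univ.powersetCard k).sup (fun S => ∑ i ∈ S, d i)

/-- `J(d)`, the sum of the `Δ(d)` largest entries of `d`. -/
def Jdeg {n : ℕ} (d : Fin n → ℕ) : ℕ := sumLargest (Δdeg d) d

/-- The ℓ₁ distance between two degree sequences. -/
def l1dist {n : ℕ} (d d' : Fin n → ℕ) : ℕ := ∑ i, ((d i : ℤ) - (d' i : ℤ)).natAbs

/-- A graphical degree sequence `d` is `(k,α)`-stable if `|Ω(d')| ≤ M(d)^α |Ω(d)|`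
for every graphical `d'` with `‖d' - d‖₁ ≤ k`. -/
def Stable {n : ℕ} (k : ℕ) (α : ℝ) (d : Fin n → ℕ) : Prop :=
  ∀ d' : Fin n → ℕ, Graphical d' → l1dist d' d ≤ k →
    ((Omega d').ncard : ℝ) ≤ (Mdeg d : ℝ) ^ α * ((Omega d).ncard : ℝ)

/-- `Ω'(d)`: union of `Ω(d')` over graphical `d' ≤ d` with `‖d - d'‖₁ ≤ 2`. -/
def OmegaPrime {n : ℕ} (d : Fin n → ℕ) : Set (SimpleGraph (Fin n)) :=
  ⋃ d' ∈ {d' : Fin n → ℕ | Graphical d' ∧ (∀ j, d' j ≤ d j) ∧ l1dist d d' ≤ 2},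
    Omega d'


open Classical in
noncomputable def dl {n : ℕ} (i : Fin n) : Fin n → ℕ := fun j => if j = i then 1 else 0

lemma dl_self {n : ℕ} (i : Fin n) : dl i i = 1 := by simp [dl]

lemma dl_ne {n : ℕ} {i j : Fin n} (h : j ≠ i) : dl i j = 0 := by simp [dl, h]

lemma Mdeg_dl {n : ℕ} (f : Fin n → ℕ) (i : Fin n) : Mdeg (f + dl i) = Mdeg f + 1 := by
  simp [Mdeg, Finset.sum_add_distrib, dl]

lemma l1_up {n : ℕ} {f d : Fin n → ℕ} {i : Fin n} (h : d i ≤ f i) :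
    l1dist (f + dl i) d = l1dist f d + 1 := by
  unfold l1dist
  rw [← Finset.add_sum_erase _ _ (Finset.mem_univ i),
    ← Finset.add_sum_erase (a := i) _ (fun j => ((f j : ℤ) - (d j : ℤ)).natAbs)
      (Finset.mem_univ i)]
  have : ∑ x ∈ univ.erase i, (((f + dl i) x : ℕ) - (d x : ℤ)).natAbs
      = ∑ x ∈ univ.erase i, ((f x : ℤ) - (d x : ℤ)).natAbs := by
    apply Finset.sum_congr rfl
    intro x hx
    simp [dl_ne (Finset.ne_of_mem_erase hx)]
  rw [this]
  simp only [Pi.add_apply, dl_self]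
  omega

lemma l1_dn {n : ℕ} {f d : Fin n → ℕ} {i : Fin n} (h : f i < d i) :
    l1dist (f + dl i) d + 1 = l1dist f d := by
  unfold l1dist
  rw [← Finset.add_sum_erase _ _ (Finset.mem_univ i),
    ← Finset.add_sum_erase (a := i) _ (fun j => ((f j : ℤ) - (d j : ℤ)).natAbs)
      (Finset.mem_univ i)]
  have : ∑ x ∈ univ.erase i, (((f + dl i) x : ℕ) - (d x : ℤ)).natAbs
      = ∑ x ∈ univ.erase i, ((f x : ℤ) - (d x : ℤ)).natAbs := by
    apply Finset.sum_congr rfl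
    intro x hx
    simp [dl_ne (Finset.ne_of_mem_erase hx)]
  rw [this]
  simp only [Pi.add_apply, dl_self]
  omega

lemma l1_le {n : ℕ} (f d : Fin n → ℕ) (i : Fin n) :
    l1dist f d ≤ l1dist (f + dl i) d + 1 := by
  rcases le_or_gt (d i) (f i) with h | h
  · rw [l1_up h]; omega
  · rw [l1_dn h]

lemma sum_le_l1 {n : ℕ} (f d : Fin n → ℕ) (S : Finset (Fin n)) :
    ∑ x ∈ S, f x ≤ ∑ x ∈ S, d x + l1dist f d := by
  have h1 : ∑ x ∈ S, ((f x : ℤ) - (d x : ℤ)).natAbs ≤ l1dist f d :=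
    Finset.sum_le_sum_of_subset (Finset.subset_univ S)
  have h2 : ∑ x ∈ S, f x ≤ ∑ x ∈ S, (d x + ((f x : ℤ) - (d x : ℤ)).natAbs) :=
    Finset.sum_le_sum (fun x _ => by omega)
  rw [Finset.sum_add_distrib] at h2
  omega

lemma l1_comm {n : ℕ} (f d : Fin n → ℕ) : l1dist f d = l1dist d f := by
  unfold l1dist
  exact Finset.sum_congr rfl (fun x _ => by omega)

lemma M_le_l1 {n : ℕ} (f d : Fin n → ℕ) : Mdeg f ≤ Mdeg d + l1dist f d := sum_le_l1 f d univ

lemma l1_zero {n : ℕ} {f d : Fin n → ℕ} (h : l1dist f d = 0) : f = d := by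
  funext i
  have := (Finset.sum_eq_zero_iff.1 h) i (Finset.mem_univ i)
  omega

open Classical in
noncomputable def drt {n : ℕ} (G : SimpleGraph (Fin n)) : Finset (Fin n × Fin n) :=
  Finset.univ.filter (fun p => G.Adj p.1 p.2)

lemma mem_drt {n : ℕ} {G : SimpleGraph (Fin n)} {x y : Fin n} :
    (x, y) ∈ drt G ↔ G.Adj x y := by simp [drt]

open Classical in
lemma degOf_eq {n : ℕ} (G : SimpleGraph (Fin n)) (i : Fin n) :
    degOf G i = (Finset.univ.filter (fun y => G.Adj i y)).card := by
  unfold degOf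
  rw [← Set.ncard_coe_finset]
  congr 1
  ext y
  simp

lemma degOf_of {n : ℕ} {G : SimpleGraph (Fin n)} {i : Fin n} {S : Finset (Fin n)}
    (hS : ∀ y, y ∈ S ↔ G.Adj i y) : degOf G i = S.card := by
  classical
  rw [degOf_eq]
  congr 1
  ext y
  simp [hS]

open Classical in
lemma card_drt_fst {n : ℕ} (G : SimpleGraph (Fin n)) (S : Finset (Fin n)) :
    ((drt G).filter (fun p => p.1 ∈ S)).card = ∑ x ∈ S, degOf G x := by
  rw [Finset.card_eq_sum_card_fiberwise (f := Prod.fst) (t := S)]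
  · apply Finset.sum_congr rfl
    intro x hx
    rw [degOf_eq]
    refine Finset.card_bij' (fun p _ => p.2) (fun y _ => (x, y)) ?_ ?_ ?_ ?_
    · rintro ⟨a, b⟩ h
      simp only [drt, Finset.mem_filter, Finset.mem_univ, true_and] at h ⊢
      rcases h with ⟨⟨h1, h2⟩, rfl⟩
      exact h1
    · intro y h
      simp only [drt, Finset.mem_filter, Finset.mem_univ, true_and] at h ⊢
      exact ⟨⟨h, hx⟩, trivial⟩
    · rintro ⟨a, b⟩ h
      simp only [drt, Finset.mem_filter, Finset.mem_univ, true_and] at h ⊢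
      rw [h.2]
    · intro y h
      rfl
  · intro p hp
    simpa using (Finset.mem_filter.1 hp).2

open Classical in
lemma card_drt_snd {n : ℕ} (G : SimpleGraph (Fin n)) (S : Finset (Fin n)) :
    ((drt G).filter (fun p => p.2 ∈ S)).card = ∑ x ∈ S, degOf G x := by
  rw [← card_drt_fst]
  refine Finset.card_bij' (fun p _ => p.swap) (fun p _ => p.swap) ?_ ?_ ?_ ?_
  · rintro ⟨a, b⟩ h
    simp only [drt, Finset.mem_filter, Finset.mem_univ, true_and, Prod.swap] at h ⊢
    exact ⟨h.1.symm, h.2⟩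
  · rintro ⟨a, b⟩ h
    simp only [drt, Finset.mem_filter, Finset.mem_univ, true_and, Prod.swap] at h ⊢
    exact ⟨h.1.symm, h.2⟩
  · intro p _; simp
  · intro p _; simp

lemma card_drt {n : ℕ} {G : SimpleGraph (Fin n)} {f : Fin n → ℕ} (h : G ∈ Omega f) :
    (drt G).card = Mdeg f := by
  have := card_drt_fst G univ
  simp only [Finset.mem_univ, Finset.filter_true] at this
  rw [this]
  exact Finset.sum_congr rfl (fun x _ => h x)

open Classical in
lemma even_M {n : ℕ} {f : Fin n → ℕ} (h : Graphical f) : Even (Mdeg f) := by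
  obtain ⟨G, hG⟩ := h
  have h1 := G.sum_degrees_eq_twice_card_edges
  have h2 : Mdeg f = ∑ v, G.degree v := by
    apply Finset.sum_congr rfl
    intro x _
    rw [← hG x, degOf_eq]
    congr 1
    ext y
    simp
  rw [h2, h1]
  exact even_two_mul _

lemma add_edge {n : ℕ} {G : SimpleGraph (Fin n)} {f : Fin n → ℕ} (h : G ∈ Omega f)
    {u x : Fin n} (hne : u ≠ x) (hn : ¬ G.Adj u x) :
    G ⊔ SimpleGraph.edge u x ∈ Omega (f + dl u + dl x) := by
  classical
  intro i
  have hi := h i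
  rw [degOf_eq] at hi
  simp only [Pi.add_apply, ← hi]
  by_cases h1 : i = u
  · subst h1
    rw [dl_self, dl_ne hne, degOf_of (S := insert x (univ.filter fun y => G.Adj i y)),
      Finset.card_insert_of_notMem (by simpa using hn)]
    intro y
    simp only [SimpleGraph.sup_adj, SimpleGraph.edge_adj, Finset.mem_filter, Finset.mem_univ,
      true_and, Finset.mem_insert]
    grind
  · by_cases h2 : i = x
    · subst h2
      rw [dl_self, dl_ne hne.symm, degOf_of (S := insert u (univ.filter fun y => G.Adj i y)),
        Finset.card_insert_of_notMem (by simpa using fun h => hn h.symm)]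
      intro y
      simp only [SimpleGraph.sup_adj, SimpleGraph.edge_adj, Finset.mem_filter, Finset.mem_univ,
        true_and, Finset.mem_insert]
      grind
    · rw [dl_ne h1, dl_ne h2, add_zero, add_zero]
      apply degOf_of
      intro y
      simp only [SimpleGraph.sup_adj, SimpleGraph.edge_adj, Finset.mem_filter, Finset.mem_univ,
        true_and]
      grind

lemma sup_sdiff_edge {n : ℕ} {G : SimpleGraph (Fin n)} {u x : Fin n} (hn : ¬ G.Adj u x) :
    (G ⊔ SimpleGraph.edge u x) \ SimpleGraph.edge u x = G := by
  ext a b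
  simp only [SimpleGraph.sdiff_adj, SimpleGraph.sup_adj, SimpleGraph.edge_adj]
  have := G.adj_comm u x
  grind

lemma sdiff_sup_edge {n : ℕ} {G : SimpleGraph (Fin n)} {u x : Fin n} (hn : G.Adj u x) :
    (G \ SimpleGraph.edge u x) ⊔ SimpleGraph.edge u x = G := by
  apply sdiff_sup_cancel
  rw [SimpleGraph.edge_le_iff]
  exact Or.inr hn

lemma rem_edge {n : ℕ} {G : SimpleGraph (Fin n)} {f : Fin n → ℕ} (h : G ∈ Omega f)
    {u x : Fin n} (hn : G.Adj u x) :
    ∃ g, f = g + dl u + dl x ∧ G \ SimpleGraph.edge u x ∈ Omega g := by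
  refine ⟨fun i => degOf (G \ SimpleGraph.edge u x) i, ?_, fun i => rfl⟩
  have h1 : ¬ (G \ SimpleGraph.edge u x).Adj u x := by
    simp only [SimpleGraph.sdiff_adj, SimpleGraph.edge_adj]
    have := hn.ne
    grind
  have h2 := add_edge (G := G \ SimpleGraph.edge u x)
    (f := fun i => degOf (G \ SimpleGraph.edge u x) i) (fun i => rfl) hn.ne h1
  rw [sdiff_sup_edge hn] at h2
  funext i
  rw [← h i, ← h2 i]

/-- sums over sets of size at most `Δ + 9` -/
lemma sum_J {n : ℕ} {d : Fin n → ℕ} (hd : Graphical d) (S : Finset (Fin n))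
    (hS : S.card ≤ Δdeg d + 9) : ∑ x ∈ S, d x ≤ Jdeg d + 9 * Δdeg d := by
  have hle : ∀ i, d i ≤ Δdeg d := fun i => Finset.le_sup (f := d) (Finset.mem_univ i)
  have hn : Δdeg d ≤ (univ : Finset (Fin n)).card := by
    classical
    apply Finset.sup_le
    intro i _
    obtain ⟨G, hG⟩ := hd
    rw [← hG i, degOf_eq]
    exact Finset.card_le_card (Finset.filter_subset _ _)
  have hJ : ∀ T : Finset (Fin n), T.card = Δdeg d → ∑ x ∈ T, d x ≤ Jdeg d := by
    intro T hT
    exact Finset.le_sup (f := fun S => ∑ i ∈ S, d i)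
      (Finset.mem_powersetCard.2 ⟨Finset.subset_univ T, hT⟩)
  rcases le_total S.card (Δdeg d) with h | h
  · obtain ⟨T, h1, _, h3⟩ := Finset.exists_subsuperset_card_eq (Finset.subset_univ S) h hn
    have := hJ T h3
    have h4 : ∑ x ∈ S, d x ≤ ∑ x ∈ T, d x := Finset.sum_le_sum_of_subset h1
    omega
  · obtain ⟨T, h1, h3⟩ := Finset.exists_subset_card_eq h
    have h4 := Finset.sum_sdiff (f := d) h1
    have h5 : ∑ x ∈ S \ T, d x ≤ (S \ T).card * Δdeg d := by
      have := Finset.sum_le_card_nsmul (S \ T) d (Δdeg d) (fun x _ => hle x)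
      simpa using this
    have h6 : (S \ T).card ≤ 9 := by
      rw [Finset.card_sdiff_of_subset h1]; omega
    have h7 := Nat.mul_le_mul_right (Δdeg d) h6
    have := hJ T h3
    omega

open Classical in
lemma nbr_sum {n : ℕ} {d f : Fin n → ℕ} (hd : Graphical d) (hf : l1dist f d ≤ 8)
    {G : SimpleGraph (Fin n)} (hG : G ∈ Omega f) (u : Fin n) :
    ∑ x ∈ insert u (univ.filter fun y => G.Adj u y), degOf G x ≤ Jdeg d + 9 * Δdeg d + 8 := by
  have h1 : ∑ x ∈ insert u (univ.filter fun y => G.Adj u y), degOf G x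
    = ∑ x ∈ insert u (univ.filter fun y => G.Adj u y), f x :=
    Finset.sum_congr rfl (fun x _ => hG x)
  have h2 := sum_le_l1 f d (insert u (univ.filter fun y => G.Adj u y))
  have h3 := sum_J hd (insert u (univ.filter fun y => G.Adj u y)) (by
    have := Finset.card_insert_le u (univ.filter fun y => G.Adj u y)
    rw [← degOf_eq, hG u] at this
    have h4 := sum_le_l1 f d {u}
    simp only [Finset.sum_singleton] at h4
    have h5 : d u ≤ Δdeg d := Finset.le_sup (f := d) (Finset.mem_univ u)
    omega)
  omega

lemma exists_dart {n : ℕ} {d f : Fin n → ℕ} (hd : Graphical d)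
    (h : Mdeg d > 2 * Jdeg d + 18 * Δdeg d + 56) (hf : l1dist f d ≤ 8)
    {G : SimpleGraph (Fin n)} (hG : G ∈ Omega f) (u v : Fin n) (p : Fin n × Fin n) :
    ∃ x y, (x, y) ≠ p ∧ G.Adj x y ∧ u ≠ x ∧ ¬ G.Adj u x ∧ v ≠ y ∧ ¬ G.Adj v y := by
  classical
  by_contra! hcon
  have hsub : drt G ⊆ ({p} ∪
      ((drt G).filter (fun q => q.1 ∈ insert u (univ.filter fun y => G.Adj u y)))) ∪
      ((drt G).filter (fun q => q.2 ∈ insert v (univ.filter fun y => G.Adj v y))) := by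
    rintro ⟨x, y⟩ hxy
    have hadj := mem_drt.1 hxy
    have := hcon x y
    simp only [Finset.mem_union, Finset.mem_filter, Finset.mem_insert, Finset.mem_singleton,
      Finset.mem_univ, true_and, hxy]
    grind
  have h1 := Finset.card_le_card hsub
  have h2 := Finset.card_union_le ({p} ∪
      ((drt G).filter (fun q => q.1 ∈ insert u (univ.filter fun y => G.Adj u y))))
      ((drt G).filter (fun q => q.2 ∈ insert v (univ.filter fun y => G.Adj v y)))
  have h3 := Finset.card_union_le {p}
      ((drt G).filter (fun q => q.1 ∈ insert u (univ.filter fun y => G.Adj u y)))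
  rw [card_drt_fst, Finset.card_singleton] at h3
  rw [card_drt_snd] at h2
  rw [card_drt hG] at h1
  have h4 := nbr_sum hd hf hG u
  have h5 := nbr_sum hd hf hG v
  have h6 := M_le_l1 d f
  rw [l1_comm] at h6
  omega

noncomputable def rec0 {n : ℕ} (H : SimpleGraph (Fin n)) (t : (Fin n × Fin n) × (Fin n × Fin n)) :
    SimpleGraph (Fin n) :=
  ((H \ SimpleGraph.edge t.2.1 t.2.2) \ SimpleGraph.edge t.1.1 t.1.2) ⊔
    SimpleGraph.edge t.1.2 t.2.2

lemma core {n : ℕ} {d f e : Fin n → ℕ} (hd : Graphical d)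
    (h : Mdeg d > 2 * Jdeg d + 18 * Δdeg d + 56)
    {G : SimpleGraph (Fin n)} (hG : G ∈ Omega f) (u v : Fin n) (p : Fin n × Fin n)
    (he : e = f + dl u + dl v) (hed : l1dist e d ≤ 6) :
    ∃ x y, (x, y) ≠ p ∧ x ≠ y ∧ ∃ H ∈ Omega e, ((u, x), (v, y)) ∈ drt H ×ˢ drt H ∧
      rec0 H ((u, x), (v, y)) = G := by
  have hf : l1dist f d ≤ 8 := by
    have h1 := l1_le f d u
    have h2 := l1_le (f + dl u) d v
    rw [he] at hed
    omega
  obtain ⟨x, y, hp, hxy, hux, hux', hvy, hvy'⟩ := exists_dart hd h hf hG u v p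
  obtain ⟨g, hg, hG0⟩ := rem_edge hG hxy
  have hxne := hxy.ne
  have a1 : ¬ (G \ SimpleGraph.edge x y).Adj u x := fun hh => hux' hh.1
  have hG1 := add_edge hG0 hux a1
  have a2 : ¬ ((G \ SimpleGraph.edge x y) ⊔ SimpleGraph.edge u x).Adj v y := by
    simp only [SimpleGraph.sup_adj, SimpleGraph.sdiff_adj, SimpleGraph.edge_adj]
    have := G.adj_comm x y
    grind
  have hG2 := add_edge hG1 hvy a2
  refine ⟨x, y, hp, hxne,
    (G \ SimpleGraph.edge x y) ⊔ SimpleGraph.edge u x ⊔ SimpleGraph.edge v y, ?_, ?_, ?_⟩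
  rotate_left 1
  · rw [Finset.mem_product, mem_drt, mem_drt]
    simp only [SimpleGraph.sup_adj, SimpleGraph.edge_adj]
    grind
  · simp only [rec0]
    rw [sup_sdiff_edge a2, sup_sdiff_edge a1, sdiff_sup_edge hxy]
  · convert hG2 using 1
    rw [he, hg]
    abel

lemma fiber {n : ℕ} {d e e' : Fin n → ℕ} (hM : 56 < Mdeg d) (he : Mdeg e' ≤ Mdeg d + 6)
    (rc : SimpleGraph (Fin n) → (Fin n × Fin n) × (Fin n × Fin n) → SimpleGraph (Fin n))
    (hR : ∀ G ∈ Omega e, ∃ H1 t1 H2 t2, t1 ≠ t2 ∧ H1 ∈ Omega e' ∧ H2 ∈ Omega e' ∧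
      t1 ∈ drt H1 ×ˢ drt H1 ∧ t2 ∈ drt H2 ×ˢ drt H2 ∧ rc H1 t1 = G ∧ rc H2 t2 = G) :
    (Omega e).ncard ≤ Mdeg d ^ 2 * (Omega e').ncard := by
  classical
  set A : Finset (SimpleGraph (Fin n)) := (Omega e).toFinite.toFinset with hA
  set B : Finset (SimpleGraph (Fin n)) := (Omega e').toFinite.toFinset with hB
  have hAc : (Omega e).ncard = A.card := Set.ncard_eq_toFinset_card _ _
  have hBc : (Omega e').ncard = B.card := Set.ncard_eq_toFinset_card _ _
  let X : Finset ((_ : SimpleGraph (Fin n)) × ((Fin n × Fin n) × (Fin n × Fin n))) :=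
    B.sigma (fun H => drt H ×ˢ drt H)
  have hX : X.card = B.card * (Mdeg e' * Mdeg e') := by
    rw [Finset.card_sigma, Finset.sum_const_nat]
    intro H hH
    rw [Finset.card_product, card_drt (by simpa [hB] using hH)]
  let Y := X.filter (fun q => rc q.1 q.2 ∈ A)
  have hY : Y.card = ∑ G ∈ A, (Y.filter (fun q => rc q.1 q.2 = G)).card :=
    Finset.card_eq_sum_card_fiberwise (fun q hq => (Finset.mem_filter.1 hq).2)
  have h2 : A.card * 2 ≤ Y.card := by
    rw [hY, ← smul_eq_mul]
    apply Finset.card_nsmul_le_sum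
    intro G hG
    obtain ⟨H1, t1, H2, t2, hne, hH1, hH2, ht1, ht2, hr1, hr2⟩ := hR G (by simpa [hA] using hG)
    have : 1 < (Y.filter (fun q => rc q.1 q.2 = G)).card := by
      rw [Finset.one_lt_card]
      refine ⟨⟨H1, t1⟩, ?_, ⟨H2, t2⟩, ?_, ?_⟩
      · refine Finset.mem_filter.2 ⟨Finset.mem_filter.2 ⟨Finset.mem_sigma.2 ⟨?_, ht1⟩, ?_⟩, hr1⟩
        · simpa [hB] using hH1
        · simpa only [hr1] using hG
      · refine Finset.mem_filter.2 ⟨Finset.mem_filter.2 ⟨Finset.mem_sigma.2 ⟨?_, ht2⟩, ?_⟩, hr2⟩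
        · simpa [hB] using hH2
        · simpa only [hr2] using hG
      · intro hh
        simp only [Sigma.mk.injEq, heq_eq_eq] at hh
        exact hne hh.2
    omega
  have h3 : Y.card ≤ X.card := Finset.card_le_card (Finset.filter_subset _ _)
  rw [hAc, hBc]
  have h4 : Mdeg e' * Mdeg e' ≤ 2 * Mdeg d ^ 2 := by
    have := Nat.mul_le_mul he he
    nlinarith
  have h5 := Nat.mul_le_mul_left B.card h4
  nlinarith

lemma step_pp {n : ℕ} {d e e' : Fin n → ℕ} (hd : Graphical d)
    (h : Mdeg d > 2 * Jdeg d + 18 * Δdeg d + 56) (i j : Fin n)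
    (he : e' = e + dl i + dl j) (hl : l1dist e' d ≤ 6) :
    (Omega e).ncard ≤ Mdeg d ^ 2 * (Omega e').ncard := by
  refine fiber (by omega) (by have := M_le_l1 e' d; omega) rec0 ?_
  intro G hG
  obtain ⟨x, y, -, -, H, hH, hm, hr⟩ := core hd h hG i j (i, i) he hl
  obtain ⟨x', y', hp, -, H', hH', hm', hr'⟩ := core hd h hG i j (x, y) he hl
  refine ⟨H, _, H', _, ?_, hH, hH', hm, hm', hr, hr'⟩
  intro hh
  simp only [Prod.mk.injEq, true_and, ne_eq] at hh hp
  exact hp ⟨hh.1.symm, hh.2.symm⟩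

lemma exists_nbr {n : ℕ} {e : Fin n → ℕ} {G : SimpleGraph (Fin n)} (hG : G ∈ Omega e) {i : Fin n}
    (hi : 0 < e i) : ∃ w, G.Adj i w := by
  classical
  rw [← hG i, degOf_eq, Finset.card_pos] at hi
  obtain ⟨w, hw⟩ := hi
  exact ⟨w, by simpa using hw⟩

lemma step_mp {n : ℕ} {d e e' f : Fin n → ℕ} (hd : Graphical d)
    (h : Mdeg d > 2 * Jdeg d + 18 * Δdeg d + 56) (i j : Fin n)
    (he : e = f + dl i) (he' : e' = f + dl j) (hl : l1dist e' d ≤ 6) :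
    (Omega e).ncard ≤ Mdeg d ^ 2 * (Omega e').ncard := by
  refine fiber (by omega) (by have := M_le_l1 e' d; omega)
    (fun H t => rec0 H t ⊔ SimpleGraph.edge i t.1.1) ?_
  intro G hG
  obtain ⟨w, hw⟩ := exists_nbr hG (i := i) (by simp [he, dl_self])
  obtain ⟨g, hg, hG0⟩ := rem_edge hG hw
  have hgg : e' = g + dl w + dl j := by
    have : f = g + dl w := by
      apply add_right_cancel (b := dl i)
      rw [← he, hg]; abel
    rw [he', this]
  obtain ⟨x, y, -, -, H, hH, hm, hr⟩ := core hd h hG0 w j (i, i) hgg hl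
  obtain ⟨x', y', hp, -, H', hH', hm', hr'⟩ := core hd h hG0 w j (x, y) hgg hl
  refine ⟨H, _, H', _, ?_, hH, hH', hm, hm', ?_, ?_⟩
  · intro hh
    simp only [Prod.mk.injEq, true_and, ne_eq] at hh hp
    exact hp ⟨hh.1.symm, hh.2.symm⟩
  · simp only [hr]
    exact sdiff_sup_edge hw
  · simp only [hr']
    exact sdiff_sup_edge hw

open Classical in
lemma step_mm {n : ℕ} {d e e' : Fin n → ℕ} (hd : Graphical d)
    (h : Mdeg d > 2 * Jdeg d + 18 * Δdeg d + 56) (i j : Fin n)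
    (he : e = e' + dl i + dl j) (hl : l1dist e' d ≤ 6) :
    (Omega e).ncard ≤ Mdeg d ^ 2 * (Omega e').ncard := by
  refine fiber (by omega) (by have := M_le_l1 e' d; omega)
    (fun H t => if t.1.2 = t.2.2 then H ⊔ SimpleGraph.edge i j else
      rec0 H t ⊔ SimpleGraph.edge j t.2.1 ⊔ SimpleGraph.edge i t.1.1) ?_
  intro G hG
  by_cases hij : G.Adj i j
  · obtain ⟨g, hg, hG0⟩ := rem_edge hG hij
    have hgg : e' = g := by
      apply add_right_cancel (b := dl i + dl j)
      rw [← add_assoc, ← add_assoc, ← he, hg]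
    subst hgg
    have hpos : 0 < (drt (G \ SimpleGraph.edge i j)).card := by
      rw [card_drt hG0]
      have := M_le_l1 d e'
      rw [l1_comm] at this
      omega
    obtain ⟨⟨a, x⟩, hax⟩ := Finset.card_pos.1 hpos
    have hax' := mem_drt.1 hax
    have hxa : (x, a) ∈ drt (G \ SimpleGraph.edge i j) := mem_drt.2 hax'.symm
    refine ⟨_, ((a, x), (a, x)), _, ((x, a), (x, a)), ?_, hG0, hG0,
      Finset.mem_product.2 ⟨hax, hax⟩, Finset.mem_product.2 ⟨hxa, hxa⟩, ?_, ?_⟩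
    · intro hh
      simp only [Prod.mk.injEq] at hh
      exact hax'.ne hh.1.1
    · simp only [if_true]
      exact sdiff_sup_edge hij
    · simp only [if_true]
      exact sdiff_sup_edge hij
  · obtain ⟨a, ha⟩ := exists_nbr hG (i := i) (by simp [he, dl_self])
    obtain ⟨g, hg, hG0⟩ := rem_edge hG ha
    have h1 : e' + dl j = g + dl a := by
      apply add_right_cancel (b := dl i)
      rw [add_right_comm, ← he, hg]; abel
    have haj : j ≠ a := by
      rintro rfl
      exact hij ha
    obtain ⟨b, hb⟩ := exists_nbr hG0 (i := j) (by
      have := congrFun h1 j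
      simp only [Pi.add_apply, dl_self, dl_ne haj] at this
      omega)
    obtain ⟨g', hg', hG1⟩ := rem_edge hG0 hb
    have hgg : e' = g' + dl a + dl b := by
      apply add_right_cancel (b := dl j)
      rw [h1, hg']; abel
    obtain ⟨x, y, -, hxy, H, hH, hm, hr⟩ := core hd h hG1 a b (i, i) hgg hl
    obtain ⟨x', y', hp, hxy', H', hH', hm', hr'⟩ := core hd h hG1 a b (x, y) hgg hl
    refine ⟨H, _, H', _, ?_, hH, hH', hm, hm', ?_, ?_⟩
    · intro hh
      simp only [Prod.mk.injEq, true_and, ne_eq] at hh hp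
      exact hp ⟨hh.1.symm, hh.2.symm⟩
    · simp only [hr, if_neg hxy]
      rw [sdiff_sup_edge hb, sdiff_sup_edge ha]
    · simp only [hr', if_neg hxy']
      rw [sdiff_sup_edge hb, sdiff_sup_edge ha]

lemma sub_dl {n : ℕ} {e : Fin n → ℕ} {i : Fin n} (hi : 0 < e i) : ∃ f, e = f + dl i := by
  refine ⟨fun j => e j - dl i j, ?_⟩
  funext j
  simp only [Pi.add_apply]
  by_cases hj : j = i
  · subst hj
    rw [dl_self]; omega
  · rw [dl_ne hj]; omega

lemma step {n : ℕ} {d e : Fin n → ℕ} (hd : Graphical d) (hge : Graphical e)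
    (h : Mdeg d > 2 * Jdeg d + 18 * Δdeg d + 56) (hne : e ≠ d) (hl : l1dist e d ≤ 8) :
    ∃ e', l1dist e' d + 2 = l1dist e d ∧
      (Omega e).ncard ≤ Mdeg d ^ 2 * (Omega e').ncard := by
  have p1 := even_M hd
  have p2 := even_M hge
  by_cases hup : ∃ i, d i < e i
  · obtain ⟨i, hi⟩ := hup
    obtain ⟨f, hf⟩ := sub_dl (e := e) (i := i) (by omega)
    have hfi : d i ≤ f i := by
      have := congrFun hf i
      simp only [Pi.add_apply, dl_self] at this
      omega
    have l1 := l1_up hfi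
    rw [← hf] at l1
    by_cases hdn : ∃ j, f j < d j
    · obtain ⟨j, hj⟩ := hdn
      have l2 := l1_dn hj
      exact ⟨f + dl j, by omega, step_mp hd h i j hf rfl (by omega)⟩
    · push Not at hdn
      have hfd : f ≠ d := by
        rintro rfl
        rw [hf, Mdeg_dl] at p2
        grind
      obtain ⟨j, hj⟩ : ∃ j, d j < f j := by
        by_contra! hcon
        exact hfd (funext fun j => le_antisymm (hcon j) (hdn j))
      obtain ⟨g, hg⟩ := sub_dl (e := f) (i := j) (by omega)
      have hgj : d j ≤ g j := by
        have := congrFun hg j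
        simp only [Pi.add_apply, dl_self] at this
        omega
      have l2 := l1_up hgj
      rw [← hg] at l2
      exact ⟨g, by omega, step_mm hd h j i (by rw [hf, hg]) (by omega)⟩
  · push Not at hup
    obtain ⟨i, hi⟩ : ∃ i, e i < d i := by
      by_contra! hcon
      exact hne (funext fun j => le_antisymm (hup j) (hcon j))
    have l1 := l1_dn hi
    have hfd : e + dl i ≠ d := by
      intro hh
      rw [← hh, Mdeg_dl] at p1
      grind
    obtain ⟨j, hj⟩ : ∃ j, (e + dl i) j < d j := by
      by_contra! hcon
      apply hfd
      funext j
      apply le_antisymm _ (hcon j)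
      simp only [Pi.add_apply]
      by_cases hji : j = i
      · subst hji
        rw [dl_self]; omega
      · rw [dl_ne hji]; exact hup j
    have l2 := l1_dn hj
    exact ⟨e + dl i + dl j, by omega, step_pp hd h i j rfl (by omega)⟩

lemma main_ind {n : ℕ} {d : Fin n → ℕ} (hd : Graphical d)
    (h : Mdeg d > 2 * Jdeg d + 18 * Δdeg d + 56) (k : ℕ) (hk : k ≤ 4) :
    ∀ e : Fin n → ℕ, l1dist e d ≤ 2 * k →
      (Omega e).ncard ≤ (Mdeg d ^ 2) ^ k * (Omega d).ncard := by
  induction k with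
  | zero =>
    intro e he
    rw [l1_zero (f := e) (d := d) (by omega)]
    simp
  | succ k ih =>
    intro e he
    by_cases hed : e = d
    · subst hed
      exact Nat.le_mul_of_pos_left _ (by have : 0 < Mdeg e := by omega
                                         positivity)
    by_cases hge : Graphical e
    · obtain ⟨e', h1, h2⟩ := step hd hge h hed (by omega)
      have h3 := ih (by omega) e' (by omega)
      calc (Omega e).ncard ≤ Mdeg d ^ 2 * (Omega e').ncard := h2
        _ ≤ Mdeg d ^ 2 * ((Mdeg d ^ 2) ^ k * (Omega d).ncard) := Nat.mul_le_mul_left _ h3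
        _ = _ := by ring
    · have : Omega e = ∅ := Set.not_nonempty_iff_eq_empty.1 hge
      simp [this]

/-- Theorem 1.3(a): if `M(d) > 2J(d) + 18Δ(d) + 56`
then `d` is `(8,8)`-stable. -/
theorem stmt_1 {n : ℕ} (d : Fin n → ℕ) (hd : Graphical d)
    (h : Mdeg d > 2 * Jdeg d + 18 * Δdeg d + 56) :
    Stable 8 8 d := by
  intro d' _ hl
  have h1 := main_ind hd h 4 le_rfl d' (by omega)
  have h2 : ((Mdeg d : ℝ) ^ (8 : ℝ)) = (Mdeg d : ℝ) ^ (8 : ℕ) := by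
    rw [← Real.rpow_natCast]
    norm_num
  rw [h2]
  have h3 : (Omega d').ncard ≤ Mdeg d ^ 8 * (Omega d).ncard := by
    rw [← pow_mul] at h1
    exact h1
  exact_mod_cast h3
end

section
/- Let D be a set of nontrivial graphical degree sequences (of varying lengths). If D is 8-stable (there exists a constant α > 0 such that every d ∈ D is (8,α)-stable), then D is P-stable (there exist constants C > 0 and t > 0 such that |Ω'(d)| ≤ C·n^t·|Ω(d)| for every d ∈ D of length n). -/
open Finset

/-- indicator of an optional index -/
def eInd {n : ℕ} (o : Option (Fin n)) (j : Fin n) : ℕ := if o = some j then 1 else 0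

lemma peel {n k : ℕ} (g : Fin n → ℕ) (hg : ∑ i, g i ≤ k + 1) :
    ∃ (o : Option (Fin n)) (g' : Fin n → ℕ), (∀ j, g j = eInd o j + g' j) ∧ ∑ i, g' i ≤ k := by
  by_cases h : ∃ i, 1 ≤ g i
  · obtain ⟨i, hi⟩ := h
    have key : ∀ j, g j = eInd (some i) j + (g j - eInd (some i) j) := by
      intro j
      unfold eInd
      by_cases hij : i = j
      · subst hij; simp; omega
      · simp [hij]
    refine ⟨some i, fun j => g j - eInd (some i) j, key, ?_⟩
    have h1 : ∑ j, g j = ∑ j, eInd (some i) j + ∑ j, (g j - eInd (some i) j) := by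
      rw [← Finset.sum_add_distrib]
      exact Finset.sum_congr rfl (fun j _ => key j)
    have h2 : ∑ j, eInd (some i) j = 1 := by simp [eInd]
    show ∑ j, (g j - eInd (some i) j) ≤ k
    omega
  · push Not at h
    refine ⟨none, g, fun j => by simp [eInd], ?_⟩
    have : ∑ i, g i = 0 := Finset.sum_eq_zero (fun i _ => by have := h i; omega)
    omega

lemma two_ind {n : ℕ} (d d' : Fin n → ℕ) (hle : ∀ j, d' j ≤ d j) (hl : l1dist d d' ≤ 2) :
    ∃ p : Option (Fin n) × Option (Fin n), d' = fun j => d j - eInd p.1 j - eInd p.2 j := by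
  have h : ∑ i, (d i - d' i) ≤ 1 + 1 := by
    have : ∑ i, (d i - d' i) = l1dist d d' := by
      unfold l1dist
      refine Finset.sum_congr rfl (fun i _ => ?_)
      have := hle i
      omega
    omega
  obtain ⟨o, g', h1, h2⟩ := peel (fun i => d i - d' i) h
  obtain ⟨o', g'', h3, h4⟩ := peel (k := 0) g' (by omega)
  refine ⟨(o, o'), ?_⟩
  funext j
  have h5 : g'' j = 0 := by
    have : g'' j ≤ ∑ i, g'' i := Finset.single_le_sum (fun _ _ => Nat.zero_le _) (Finset.mem_univ j)
    omega
  have := h1 j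
  have := h3 j
  have := hle j
  simp only at *
  omega

lemma Mdeg_le {n : ℕ} (d : Fin n → ℕ) (h : Graphical d) : Mdeg d ≤ n * n := by
  obtain ⟨G, hG⟩ := h
  unfold Mdeg
  calc ∑ i, d i ≤ ∑ _i : Fin n, n := by
        refine Finset.sum_le_sum (fun i _ => ?_)
        rw [← hG i]
        unfold degOf
        calc _ ≤ (Set.univ : Set (Fin n)).ncard := Set.ncard_le_ncard (Set.subset_univ _)
          _ = n := by simp [Set.ncard_univ]
    _ = n * n := by simp

lemma l1dist_comm {n : ℕ} (d d' : Fin n → ℕ) : l1dist d d' = l1dist d' d := by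
  unfold l1dist
  exact Finset.sum_congr rfl (fun i _ => by omega)

lemma prime_bound {n : ℕ} (d : Fin n → ℕ) (B : ℝ) (hB : 0 ≤ B)
    (h : ∀ d' : Fin n → ℕ, Graphical d' → l1dist d' d ≤ 8 → ((Omega d').ncard : ℝ) ≤ B) :
    ((OmegaPrime d).ncard : ℝ) ≤ ((n : ℝ) + 1) ^ 2 * B := by
  classical
  let f : Option (Fin n) × Option (Fin n) → Fin n → ℕ := fun p j => d j - eInd p.1 j - eInd p.2 j
  let S : Option (Fin n) × Option (Fin n) → Set (SimpleGraph (Fin n)) := fun p =>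
    if l1dist (f p) d ≤ 8 then Omega (f p) else ∅
  have hsub : OmegaPrime d ⊆ ⋃ p ∈ (Finset.univ : Finset (Option (Fin n) × Option (Fin n))), S p := by
    intro G hG
    simp only [OmegaPrime, Set.mem_iUnion] at hG
    obtain ⟨d', ⟨_, hle, hl⟩, hG⟩ := hG
    obtain ⟨p, hp⟩ := two_ind d d' hle hl
    simp only [Set.mem_iUnion]
    refine ⟨p, Finset.mem_univ _, ?_⟩
    have e : f p = d' := hp.symm
    have : l1dist (f p) d ≤ 8 := by rw [e, l1dist_comm]; omega
    simp only [S, if_pos this]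
    rw [e]; exact hG
  have hS : ∀ p, ((S p).ncard : ℝ) ≤ B := by
    intro p
    by_cases hp : l1dist (f p) d ≤ 8
    · simp only [S, if_pos hp]
      by_cases hg : Graphical (f p)
      · exact h _ hg hp
      · rw [Graphical, Set.not_nonempty_iff_eq_empty] at hg
        simp [hg, hB]
    · simp [S, if_neg hp, hB]
  have h1 : (OmegaPrime d).ncard ≤ ∑ p, (S p).ncard :=
    (Set.ncard_le_ncard hsub (Set.toFinite _)).trans (Finset.set_ncard_biUnion_le _ _)
  calc ((OmegaPrime d).ncard : ℝ) ≤ ((∑ p, (S p).ncard : ℕ) : ℝ) := by exact_mod_cast h1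
    _ = ∑ p, ((S p).ncard : ℝ) := by push_cast; rfl
    _ ≤ ∑ _p : Option (Fin n) × Option (Fin n), B := Finset.sum_le_sum (fun p _ => hS p)
    _ = ((n : ℝ) + 1) ^ 2 * B := by
        rw [Finset.sum_const, Finset.card_univ, Fintype.card_prod, Fintype.card_option,
          Fintype.card_fin, nsmul_eq_mul]
        push_cast
        ring

/-- Proposition 6.3: an 8-stable family of nontrivial graphical
degree sequences is P-stable. -/
theorem stmt_5 (D : (n : ℕ) → Set (Fin n → ℕ))
    (hD : ∀ n, ∀ d ∈ D n, Graphical d ∧ ∀ i, 1 ≤ d i)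
    (h8 : ∃ α > (0 : ℝ), ∀ n, ∀ d ∈ D n, Stable 8 α d) :
    ∃ C > (0 : ℝ), ∃ t > (0 : ℝ), ∀ n, ∀ d ∈ D n,
      ((OmegaPrime d).ncard : ℝ) ≤ C * (n : ℝ) ^ t * ((Omega d).ncard : ℝ) := by
  obtain ⟨α, hα, hst⟩ := h8
  refine ⟨4, by norm_num, 2 * α + 2, by linarith, ?_⟩
  intro n d hd
  have hs := hst n d hd
  have hg := (hD n d hd).1
  have hM := Mdeg_le d hg
  have hpos : 0 < (Omega d).ncard := (Set.ncard_pos (Set.toFinite _)).2 hg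
  have hpos' : (0 : ℝ) < (Omega d).ncard := by exact_mod_cast hpos
  have hn : 1 ≤ n := by
    rcases Nat.eq_zero_or_pos n with h0 | h0
    · exfalso
      have h1 := hs d hg (by simp [l1dist])
      have h2 : Mdeg d = 0 := by subst h0; simpa using hM
      rw [h2, Nat.cast_zero, Real.zero_rpow hα.ne', zero_mul] at h1
      linarith
    · exact h0
  have hn' : (1 : ℝ) ≤ n := by exact_mod_cast hn
  have hb := prime_bound d _ (by positivity) hs
  refine hb.trans ?_
  rw [← mul_assoc]
  refine mul_le_mul_of_nonneg_right ?_ hpos'.le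
  have hMα : (Mdeg d : ℝ) ^ α ≤ (n : ℝ) ^ (2 * α) := by
    rw [Real.rpow_mul (by positivity)]
    refine Real.rpow_le_rpow (by positivity) ?_ hα.le
    rw [Real.rpow_two, sq]
    exact_mod_cast hM
  rw [Real.rpow_add (by linarith), Real.rpow_two]
  have h4 : ((n : ℝ) + 1) ^ 2 ≤ 4 * (n : ℝ) ^ 2 := by nlinarith
  calc ((n : ℝ) + 1) ^ 2 * (Mdeg d : ℝ) ^ α ≤ (4 * (n : ℝ) ^ 2) * (n : ℝ) ^ (2 * α) := by gcongr
    _ = _ := by ring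
end
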